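/- Let d ≥ 3. Define η ∈ ℝ^{d+1} by η_1 = η_2 = (d−2)/2, η_j = −1 for 3 ≤ j ≤ d−1, η_d = 0, η_{d+1} = 1, and define η̃ identically except η̃_{d+1} = −1. Then ρ(η) and ρ(η̃) are pure states, and for every ξ ∈ ℝ^{d+1} satisfying the section constraints with 0 < r(ξ) < 1, the following are equivalent: (1) D(ρ(η)‖ρ(ξ)) = D(ρ(η̃)‖ρ(ξ)); (2) Σ_{i=1}^{d+1} (η_i − ξ_i)² = Σ_{i=1}^{d+1} (η̃_i − ξ_i)²; (3) ξ_{d+1} = 0. In particular, for this pair of sites the divergence bisector and the Euclidean-parameter bisector coincide. -/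

import Mathlib

open scoped ComplexOrder

open Matrix Finset in
noncomputable def matLog {n : Type*} [Fintype n] [DecidableEq n]
    (A : Matrix n n ℂ) : Matrix n n ℂ := cfc Real.log A

noncomputable def qDiv {n : Type*} [Fintype n] [DecidableEq n]
    (σ ρ : Matrix n n ℂ) : ℝ := (Matrix.trace (σ * (matLog σ - matLog ρ))).re

noncomputable def rho (d : ℕ) (ξ : ℕ → ℝ) : Matrix (Fin d) (Fin d) ℂ :=
  fun i j =>
    if i = j then
      if (i : ℕ) = d - 1 then (((1 - ∑ k ∈ Finset.Icc 1 (d - 1), ξ k) / d : ℝ) : ℂ)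
      else (((ξ ((i : ℕ) + 1) + 1) / d : ℝ) : ℂ)
    else if (i : ℕ) = 0 ∧ (j : ℕ) = 1 then ((ξ d : ℂ) - Complex.I * (ξ (d + 1) : ℂ)) / 2
    else if (i : ℕ) = 1 ∧ (j : ℕ) = 0 then ((ξ d : ℂ) + Complex.I * (ξ (d + 1) : ℂ)) / 2
    else 0

noncomputable def rParam (d : ℕ) (ξ : ℕ → ℝ) : ℝ :=
  Real.sqrt ((ξ 1 - ξ 2) ^ 2 / (d : ℝ) ^ 2 + ξ d ^ 2 + ξ (d + 1) ^ 2)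

noncomputable def lam1 (d : ℕ) (ξ : ℕ → ℝ) : ℝ :=
  (ξ 1 + ξ 2 + 2) / (2 * d) + rParam d ξ / 2

noncomputable def lam2 (d : ℕ) (ξ : ℕ → ℝ) : ℝ :=
  (ξ 1 + ξ 2 + 2) / (2 * d) - rParam d ξ / 2

def SectionConstraints (d : ℕ) (ξ : ℕ → ℝ) : Prop :=
  ξ 1 + ξ 2 = (d : ℝ) - 2 ∧ ∀ j : ℕ, 3 ≤ j → j ≤ d - 1 → ξ j = -1

noncomputable def firstTwoIsometry (d : ℕ) : Matrix (Fin d) (Fin 2) ℂ :=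
  fun i k => if (i : ℕ) = (k : ℕ) then 1 else 0

noncomputable def qubitBlock (a b x y : ℝ) : Matrix (Fin 2) (Fin 2) ℂ :=
  !![(a : ℂ), ((x : ℂ) - Complex.I * y) / 2; ((x : ℂ) + Complex.I * y) / 2, (b : ℂ)]

open Matrix in
theorem firstTwoIsometry_conjTranspose_mul_self {d : ℕ} (hd : 2 ≤ d) :
    (firstTwoIsometry d)ᴴ * firstTwoIsometry d = 1 := by
  obtain ⟨n, rfl⟩ := Nat.exists_eq_add_of_le' hd
  ext i j
  fin_cases i <;> fin_cases j <;>
    simp [firstTwoIsometry, Matrix.mul_apply, Fin.sum_univ_succ]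

theorem sum_Icc_of_sectionConstraints {d : ℕ} (hd : 3 ≤ d) {ξ : ℕ → ℝ}
    (h : SectionConstraints d ξ) : ∑ k ∈ Finset.Icc 1 (d - 1), ξ k = 1 := by
  obtain ⟨n, rfl⟩ := Nat.exists_eq_add_of_le' hd
  obtain ⟨h12, hj⟩ := h
  have e : Finset.Icc 1 (n + 3 - 1) = insert 1 (insert 2 (Finset.Icc 3 (n + 2))) := by
    ext k; simp only [Finset.mem_Icc, Finset.mem_insert]; omega
  have hsum : ∑ k ∈ Finset.Icc 3 (n + 2), ξ k = -n := by
    have hc : ∀ k ∈ Finset.Icc 3 (n + 2), ξ k = -1 := fun k hk =>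
      hj k (Finset.mem_Icc.1 hk).1 (Finset.mem_Icc.1 hk).2
    rw [Finset.sum_congr rfl hc]
    simp
  rw [e, Finset.sum_insert (by simp), Finset.sum_insert (by simp), hsum]
  push_cast at h12
  linarith

open Matrix in
theorem rho_eq_of_sectionConstraints {d : ℕ} (hd : 3 ≤ d) {ξ : ℕ → ℝ}
    (h : SectionConstraints d ξ) :
    rho d ξ = firstTwoIsometry d *
      qubitBlock ((ξ 1 + 1) / d) ((ξ 2 + 1) / d) (ξ d) (ξ (d + 1)) * (firstTwoIsometry d)ᴴ := by
  have hs := sum_Icc_of_sectionConstraints hd h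
  have entry (i j : Fin d) : (firstTwoIsometry d *
      qubitBlock ((ξ 1 + 1) / d) ((ξ 2 + 1) / d) (ξ d) (ξ (d + 1)) * (firstTwoIsometry d)ᴴ) i j =
      if (i : ℕ) = 0 then (if (j : ℕ) = 0 then (((ξ 1 + 1) / d : ℝ) : ℂ) else
        if (j : ℕ) = 1 then ((ξ d : ℂ) - Complex.I * (ξ (d + 1) : ℂ)) / 2 else 0)
      else if (i : ℕ) = 1 then (if (j : ℕ) = 0 then ((ξ d : ℂ) + Complex.I * (ξ (d + 1) : ℂ)) / 2
        else if (j : ℕ) = 1 then (((ξ 2 + 1) / d : ℝ) : ℂ) else 0) else 0 := by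
    simp only [Matrix.mul_apply, Fin.sum_univ_two, firstTwoIsometry, qubitBlock,
      Matrix.conjTranspose_apply]
    by_cases hi : (i : ℕ) = 0 <;> by_cases hi1 : (i : ℕ) = 1 <;>
    by_cases hj : (j : ℕ) = 0 <;> by_cases hj1 : (j : ℕ) = 1 <;>
      first | omega | simp [hi, hi1, hj, hj1]
  ext i j
  rw [entry, rho]
  by_cases hij : i = j
  · subst hij
    by_cases hlast : (i : ℕ) = d - 1
    · have h0 : (i : ℕ) ≠ 0 := by omega
      have h1 : (i : ℕ) ≠ 1 := by omega
      simp only [if_true, if_pos hlast, if_neg h0, if_neg h1, hs]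
      simp
    · by_cases h0 : (i : ℕ) = 0
      · simp [h0, show 0 ≠ d - 1 by omega]
      · by_cases h1 : (i : ℕ) = 1
        · simp [h1, show 1 ≠ d - 1 by omega]
        · rw [if_pos rfl, if_neg hlast, if_neg h0, if_neg h1,
            h.2 ((i : ℕ) + 1) (by omega) (by omega)]
          simp
  · have hij' : (i : ℕ) ≠ j := fun h => hij (Fin.ext h)
    rw [if_neg hij]
    by_cases hi : (i : ℕ) = 0 <;> by_cases hi1 : (i : ℕ) = 1 <;>
    by_cases hj : (j : ℕ) = 0 <;> by_cases hj1 : (j : ℕ) = 1 <;>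
      first | omega | simp [hi, hi1, hj, hj1]

theorem qubitBlock_isSelfAdjoint (a b x y : ℝ) : IsSelfAdjoint (qubitBlock a b x y) := by
  ext i j
  fin_cases i <;> fin_cases j <;> simp [qubitBlock, Matrix.star_apply]
  ring

theorem qubitBlock_mul_self {a b : ℝ} (x y : ℝ) (h : a + b = 1) :
    qubitBlock a b x y * qubitBlock a b x y = qubitBlock a b x y -
      ((1 - ((a - b) ^ 2 + x ^ 2 + y ^ 2)) / 4 : ℝ) • (1 : Matrix (Fin 2) (Fin 2) ℂ) := by
  obtain rfl : b = 1 - a := by linarith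
  ext i j
  fin_cases i <;> fin_cases j <;>
    simp [qubitBlock, Matrix.mul_apply, Fin.sum_univ_two, Complex.real_smul] <;>
    ring_nf <;> simp [Complex.I_sq] <;> ring

theorem spectrum_real_pow_three {n : Type*} [Fintype n] [DecidableEq n] [Nonempty n]
    {A : Matrix n n ℂ} {s : ℝ} (h : A ^ 3 = A ^ 2 - s • A) {t : ℝ} (ht : t ∈ spectrum ℝ A) :
    t ^ 3 = t ^ 2 - s * t := by
  let f : Polynomial ℝ := Polynomial.X ^ 3 - Polynomial.X ^ 2 + Polynomial.C s * Polynomial.X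
  have hf : Polynomial.aeval A f = 0 := by
    simp [f, h, Algebra.algebraMap_eq_smul_one]
  have hroot : f.eval t ∈ spectrum ℝ (Polynomial.aeval A f) :=
    spectrum.subset_polynomial_aeval A f ⟨t, ht, rfl⟩
  rw [hf, spectrum.zero_eq, Set.mem_singleton_iff] at hroot
  simp [f] at hroot
  linarith

theorem matLog_eq_of_pow_three {n : Type*} [Fintype n] [DecidableEq n] [Nonempty n]
    {A : Matrix n n ℂ} (hA : IsSelfAdjoint A) {s p q : ℝ} (h : A ^ 3 = A ^ 2 - s • A)
    (hlog : ∀ t : ℝ, t ≠ 0 → t ^ 2 = t - s → Real.log t = p * t + q * t ^ 2) :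
    matLog A = p • A + q • A ^ 2 := by
  have : matLog A = cfc (fun t : ℝ => p * t + q * t ^ 2) A := by
    refine cfc_congr fun t ht => ?_
    have h3 := spectrum_real_pow_three h ht
    rcases eq_or_ne t 0 with rfl | h0
    · simp
    · exact hlog t h0 (mul_left_cancel₀ h0 (by linarith))
  rw [this, cfc_add .., cfc_const_mul .., cfc_const_mul .., cfc_pow .., cfc_id' ..]

theorem exists_log_eq_quadratic {r : ℝ} (h0 : 0 < r) (h1 : r < 1) :
    ∃ p q : ℝ, 0 < p + q ∧ ∀ t : ℝ, t ^ 2 = t - (1 - r ^ 2) / 4 →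
      Real.log t = p * t + q * t ^ 2 := by
  set u := (1 + r) / 2 with hu
  set v := (1 - r) / 2 with hv
  have hu0 : 0 < u := by positivity
  have hv0 : 0 < v := by linarith
  have huv : Real.log v < Real.log u := Real.log_lt_log hv0 (by linarith)
  have hr : u - v = r := by ring
  have hr1 : u + v = 1 := by ring
  refine ⟨(Real.log v / v * u - Real.log u / u * v) / r,
    (Real.log u / u - Real.log v / v) / r, ?_, fun t ht => ?_⟩
  · have : (Real.log v / v * u - Real.log u / u * v) / r + (Real.log u / u - Real.log v / v) / r
        = (Real.log u - Real.log v) / r := by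
      rw [show v = 1 - u by linarith] at *
      field_simp
      ring
    rw [this]
    exact div_pos (by linarith) h0
  · have : (t - u) * (t - v) = 0 := by rw [hu, hv]; linarith
    rcases mul_eq_zero.1 this with h | h
    · rw [sub_eq_zero.1 h, ← hr]
      have : u - v ≠ 0 := by linarith
      field_simp
      ring
    · rw [sub_eq_zero.1 h, ← hr]
      have : u - v ≠ 0 := by linarith
      field_simp
      ring

open Matrix in
theorem compression_mul {d : ℕ} (hd : 2 ≤ d) (B C : Matrix (Fin 2) (Fin 2) ℂ) :
    (firstTwoIsometry d * B * (firstTwoIsometry d)ᴴ) *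
    (firstTwoIsometry d * C * (firstTwoIsometry d)ᴴ) =
    firstTwoIsometry d * (B * C) * (firstTwoIsometry d)ᴴ := by
  have := firstTwoIsometry_conjTranspose_mul_self hd
  calc _ = firstTwoIsometry d * B * ((firstTwoIsometry d)ᴴ * firstTwoIsometry d) * C *
        (firstTwoIsometry d)ᴴ := by simp only [Matrix.mul_assoc]
    _ = _ := by rw [this, Matrix.mul_one]; simp only [Matrix.mul_assoc]

open Matrix in
theorem trace_compression {d : ℕ} (hd : 2 ≤ d) (B : Matrix (Fin 2) (Fin 2) ℂ) :
    trace (firstTwoIsometry d * B * (firstTwoIsometry d)ᴴ) = trace B := by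
  rw [Matrix.trace_mul_comm, ← Matrix.mul_assoc, firstTwoIsometry_conjTranspose_mul_self hd,
    Matrix.one_mul]

open Matrix in
theorem compression_isSelfAdjoint (d : ℕ) {B : Matrix (Fin 2) (Fin 2) ℂ} (hB : IsSelfAdjoint B) :
    IsSelfAdjoint (firstTwoIsometry d * B * (firstTwoIsometry d)ᴴ) :=
  Matrix.isHermitian_mul_mul_conjTranspose _ hB

theorem diag_add_of_sectionConstraints {d : ℕ} (hd : 3 ≤ d) {ξ : ℕ → ℝ}
    (h : SectionConstraints d ξ) : (ξ 1 + 1) / (d : ℝ) + (ξ 2 + 1) / d = 1 := by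
  have : (d : ℝ) ≠ 0 := by positivity
  field_simp
  linarith [h.1]

theorem qubitBlock_mul_self_of_sectionConstraints {d : ℕ} (hd : 3 ≤ d) {ξ : ℕ → ℝ}
    (h : SectionConstraints d ξ) :
    qubitBlock ((ξ 1 + 1) / d) ((ξ 2 + 1) / d) (ξ d) (ξ (d + 1)) *
      qubitBlock ((ξ 1 + 1) / d) ((ξ 2 + 1) / d) (ξ d) (ξ (d + 1)) =
    qubitBlock ((ξ 1 + 1) / d) ((ξ 2 + 1) / d) (ξ d) (ξ (d + 1)) -
      ((1 - rParam d ξ ^ 2) / 4) • (1 : Matrix (Fin 2) (Fin 2) ℂ) := by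
  rw [qubitBlock_mul_self _ _ (diag_add_of_sectionConstraints hd h), rParam,
    Real.sq_sqrt (by positivity)]
  congr 4
  ring

theorem rho_isSelfAdjoint {d : ℕ} (hd : 3 ≤ d) {ξ : ℕ → ℝ}
    (h : SectionConstraints d ξ) : IsSelfAdjoint (rho d ξ) := by
  rw [rho_eq_of_sectionConstraints hd h]
  exact compression_isSelfAdjoint d (qubitBlock_isSelfAdjoint ..)

theorem trace_rho {d : ℕ} (hd : 3 ≤ d) {ξ : ℕ → ℝ}
    (h : SectionConstraints d ξ) : (rho d ξ).trace = 1 := by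
  have := diag_add_of_sectionConstraints hd h
  rw [rho_eq_of_sectionConstraints hd h, trace_compression (by omega)]
  simp only [qubitBlock, Matrix.trace_fin_two_of]
  exact_mod_cast this

theorem rho_pow_three {d : ℕ} (hd : 3 ≤ d) {ξ : ℕ → ℝ} (h : SectionConstraints d ξ) :
    rho d ξ ^ 3 = rho d ξ ^ 2 - ((1 - rParam d ξ ^ 2) / 4) • rho d ξ := by
  have hd2 : 2 ≤ d := by omega
  rw [pow_succ, pow_two, rho_eq_of_sectionConstraints hd h, compression_mul hd2,
    compression_mul hd2]
  have hB := qubitBlock_mul_self_of_sectionConstraints hd h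
  generalize qubitBlock ((ξ 1 + 1) / d) ((ξ 2 + 1) / d) (ξ d) (ξ (d + 1)) = B at hB ⊢
  have hB3 : B * B * B = B * B - ((1 - rParam d ξ ^ 2) / 4) • B := by
    nth_rw 1 [hB]
    simp [Matrix.sub_mul]
  simp [hB3, Matrix.mul_sub, Matrix.sub_mul]

theorem rho_sq_of_rParam_eq_one {d : ℕ} (hd : 3 ≤ d) {ξ : ℕ → ℝ} (h : SectionConstraints d ξ)
    (hr : rParam d ξ = 1) : rho d ξ ^ 2 = rho d ξ := by
  have hd2 : 2 ≤ d := by omega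
  rw [pow_two, rho_eq_of_sectionConstraints hd h, compression_mul hd2,
    qubitBlock_mul_self_of_sectionConstraints hd h, hr]
  simp

theorem matLog_rho_of_rParam_eq_one {d : ℕ} (hd : 3 ≤ d) {ξ : ℕ → ℝ} (h : SectionConstraints d ξ)
    (hr : rParam d ξ = 1) : matLog (rho d ξ) = 0 := by
  have : Nonempty (Fin d) := ⟨⟨0, by omega⟩⟩
  rw [matLog_eq_of_pow_three (p := 0) (q := 0) (rho_isSelfAdjoint hd h) (rho_pow_three hd h)]
  · simp
  · intro t ht h2
    rw [hr] at h2
    obtain rfl : t = 1 := mul_left_cancel₀ ht (by linarith)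
    simp

theorem rho_pure_of_rParam_eq_one {d : ℕ} (hd : 3 ≤ d) {ξ : ℕ → ℝ} (h : SectionConstraints d ξ)
    (hr : rParam d ξ = 1) :
    (rho d ξ).PosSemidef ∧ (rho d ξ).rank = 1 := by
  have hsq := rho_sq_of_rParam_eq_one hd h hr
  have hA : (rho d ξ).IsHermitian := rho_isSelfAdjoint hd h
  refine ⟨?_, ?_⟩
  · have := Matrix.posSemidef_conjTranspose_mul_self (rho d ξ)
    rwa [hA.eq, ← pow_two, hsq] at this
  · have hidem : IsIdempotentElem (Matrix.toLin' (rho d ξ)) := by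
      rw [IsIdempotentElem, Module.End.mul_eq_comp, ← Matrix.toLin'_mul, ← pow_two, hsq]
    have ht := (LinearMap.IsIdempotentElem.isProj_range _ hidem).trace
    rw [Matrix.trace_toLin'_eq, trace_rho hd h] at ht
    rw [Matrix.rank, ← Matrix.toLin'_apply']
    exact_mod_cast ht.symm

theorem exists_qDiv_eq_sub_inner {d : ℕ} (hd : 3 ≤ d) {ξ : ℕ → ℝ} (h : SectionConstraints d ξ)
    (h0 : 0 < rParam d ξ) (h1 : rParam d ξ < 1) :
    ∃ c e : ℝ, 0 < c ∧ ∀ η : ℕ → ℝ, SectionConstraints d η → rParam d η = 1 →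
      qDiv (rho d η) (rho d ξ) = e - c * ((η 1 + 1) / d * ((ξ 1 + 1) / d) +
        (η 2 + 1) / d * ((ξ 2 + 1) / d) + (η d * ξ d + η (d + 1) * ξ (d + 1)) / 2) := by
  have hd2 : 2 ≤ d := by omega
  have : Nonempty (Fin d) := ⟨⟨0, by omega⟩⟩
  obtain ⟨p, q, hpq, hlog⟩ := exists_log_eq_quadratic h0 h1
  refine ⟨p + q, q * ((1 - rParam d ξ ^ 2) / 4), hpq, fun η hη hr => ?_⟩
  have htr : (rho d η * rho d ξ).trace.re = (η 1 + 1) / d * ((ξ 1 + 1) / d) +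
        (η 2 + 1) / d * ((ξ 2 + 1) / d) + (η d * ξ d + η (d + 1) * ξ (d + 1)) / 2 := by
    rw [rho_eq_of_sectionConstraints hd h, rho_eq_of_sectionConstraints hd hη,
      compression_mul hd2, trace_compression hd2]
    generalize (η 1 + 1) / (d : ℝ) = a, (ξ 1 + 1) / (d : ℝ) = a', (η 2 + 1) / (d : ℝ) = b,
      (ξ 2 + 1) / (d : ℝ) = b'
    simp [qubitBlock, Matrix.trace_fin_two]
    ring
  have htr2 : (rho d η * rho d ξ ^ 2).trace =
      (rho d η * rho d ξ).trace - ((1 - rParam d ξ ^ 2) / 4 : ℝ) := by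
    have ht := trace_rho hd hη
    rw [rho_eq_of_sectionConstraints hd hη, trace_compression hd2] at ht
    rw [pow_two, rho_eq_of_sectionConstraints hd h, rho_eq_of_sectionConstraints hd hη,
      compression_mul hd2, compression_mul hd2, compression_mul hd2,
      trace_compression hd2, trace_compression hd2,
      qubitBlock_mul_self_of_sectionConstraints hd h, Matrix.mul_sub, Matrix.trace_sub,
      Matrix.mul_smul, Matrix.mul_one, Matrix.trace_smul, ht, Complex.real_smul, mul_one]
  rw [qDiv, matLog_rho_of_rParam_eq_one hd hη hr,
    matLog_eq_of_pow_three (rho_isSelfAdjoint hd h) (rho_pow_three hd h) fun t _ => hlog t,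
    zero_sub, Matrix.mul_neg, Matrix.mul_add, Matrix.mul_smul, Matrix.mul_smul, Matrix.trace_neg,
    Matrix.trace_add, Matrix.trace_smul, Matrix.trace_smul, htr2, ← htr]
  simp only [Complex.neg_re, Complex.add_re, Complex.smul_re, Complex.sub_re, Complex.ofReal_re,
    smul_eq_mul]
  ring

theorem example_two_bisectors_coincide (d : ℕ) (hd : 3 ≤ d) (η η' : ℕ → ℝ)
    (hη1 : η 1 = ((d : ℝ) - 2) / 2) (hη2 : η 2 = ((d : ℝ) - 2) / 2)
    (hηj : ∀ j : ℕ, 3 ≤ j → j ≤ d - 1 → η j = -1)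
    (hηd : η d = 0) (hηd1 : η (d + 1) = 1)
    (hη'1 : η' 1 = ((d : ℝ) - 2) / 2) (hη'2 : η' 2 = ((d : ℝ) - 2) / 2)
    (hη'j : ∀ j : ℕ, 3 ≤ j → j ≤ d - 1 → η' j = -1)
    (hη'd : η' d = 0) (hη'd1 : η' (d + 1) = -1) :
    ((rho d η).PosSemidef ∧ (rho d η).rank = 1) ∧
    ((rho d η').PosSemidef ∧ (rho d η').rank = 1) ∧
    ∀ ξ : ℕ → ℝ, SectionConstraints d ξ → 0 < rParam d ξ → rParam d ξ < 1 →
      ((qDiv (rho d η) (rho d ξ) = qDiv (rho d η') (rho d ξ) ↔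
          ∑ i ∈ Finset.Icc 1 (d + 1), (η i - ξ i) ^ 2 =
            ∑ i ∈ Finset.Icc 1 (d + 1), (η' i - ξ i) ^ 2) ∧
        (∑ i ∈ Finset.Icc 1 (d + 1), (η i - ξ i) ^ 2 =
            ∑ i ∈ Finset.Icc 1 (d + 1), (η' i - ξ i) ^ 2 ↔
          ξ (d + 1) = 0)) := by
  have hS : SectionConstraints d η := ⟨by rw [hη1, hη2]; ring, hηj⟩
  have hS' : SectionConstraints d η' := ⟨by rw [hη'1, hη'2]; ring, hη'j⟩
  have hr : rParam d η = 1 := by simp [rParam, hη1, hη2, hηd, hηd1]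
  have hr' : rParam d η' = 1 := by simp [rParam, hη'1, hη'2, hη'd, hη'd1]
  refine ⟨rho_pure_of_rParam_eq_one hd hS hr, rho_pure_of_rParam_eq_one hd hS' hr',
    fun ξ hξ h0 h1 => ?_⟩
  have euclid : ∑ i ∈ Finset.Icc 1 (d + 1), (η i - ξ i) ^ 2 =
      ∑ i ∈ Finset.Icc 1 (d + 1), (η' i - ξ i) ^ 2 ↔ ξ (d + 1) = 0 := by
    have hη : ∀ i ∈ Finset.Icc 1 d, (η i - ξ i) ^ 2 = (η' i - ξ i) ^ 2 := by
      intro i hi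
      rw [Finset.mem_Icc] at hi
      rcases (by omega : i = 1 ∨ i = 2 ∨ (3 ≤ i ∧ i ≤ d - 1) ∨ i = d) with rfl | rfl | hi | rfl
      · rw [hη1, hη'1]
      · rw [hη2, hη'2]
      · rw [hηj i hi.1 hi.2, hη'j i hi.1 hi.2]
      · rw [hηd, hη'd]
    rw [Finset.sum_Icc_succ_top (by omega), Finset.sum_Icc_succ_top (by omega),
      Finset.sum_congr rfl hη, hηd1, hη'd1, add_right_inj]
    constructor <;> intro h <;> nlinarith
  have div : qDiv (rho d η) (rho d ξ) = qDiv (rho d η') (rho d ξ) ↔ ξ (d + 1) = 0 := by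
    obtain ⟨c, e, hc, hq⟩ := exists_qDiv_eq_sub_inner hd hξ h0 h1
    rw [hq η hS hr, hq η' hS' hr', hη1, hη2, hηd, hηd1, hη'1, hη'2, hη'd, hη'd1]
    constructor
    · intro h
      have : c * ξ (d + 1) = 0 := by linear_combination -h
      exact (mul_eq_zero.1 this).resolve_left hc.ne'
    · intro h
      rw [h]
      ring
  exact ⟨div.trans euclid.symm, euclid⟩
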